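/- arXiv:1803.04929 — 5 statements merged into one kernel-verified Lean document; each statement's English description precedes it below -/
import Mathlib

section
/- Let p̂ be a probability mass function on a finite product space ∏_{i=1}^d 𝒳_i and let Î denote conditional mutual information computed under p̂; let p be another pmf on the same space (the true distribution), λ > 0 and n ≥ 1. Assume: (a) for all distinct j,k and all S ⊆ {1,…,d}\{j,k}, if I_p(X_j; X_k | X_S) = 0 then Î(X_j; X_k | X_S) < λ/n; (b) if I_p(X_j; X_k | X_S) ≠ 0 then Î(X_j; X_k | X_S) > λ/n. Then for any directed graph Ĝ on nodes {1,…,d} not containing the edge k→j, the graph Ĝ' obtained by adding the edge k→j satisfies L^S(Ĝ') − L^S(Ĝ) = λ/n − Î(X_j; X_k | X_{Pa(Ĝ,j)}); consequently L^S(Ĝ') > L^S(Ĝ) if I_p(X_j; X_k | X_{Pa(Ĝ,j)}) = 0, and L^S(Ĝ') < L^S(Ĝ) if I_p(X_j; X_k | X_{Pa(Ĝ,j)}) ≠ 0. -/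
/-- The probability of an event `A` under a probability mass function `p` on a finite
space: `∑_{x ∈ A} p x`. -/
noncomputable def fpr {Ω : Type*} [Fintype Ω] (p : Ω → ℝ) (A : Set Ω) : ℝ :=
  ∑ x : Ω, A.indicator p x

/-- Conditional mutual information `I(U;V|W)` computed under a probability mass function `p`
on a finite space, defined as
`∑ u v w P(U=u,V=v,W=w) log (P(U=u,V=v|W=w) / (P(U=u|W=w)·P(V=v|W=w)))`.
Since, in Lean, division by zero yields `0` and `Real.log 0 = 0`, terms with
`P(W=w)=0` or `P(U=u,V=v,W=w)=0` contribute `0`, matching the usual convention. -/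
noncomputable def fCondMI {Ω α β γ : Type*} [Fintype Ω] [Fintype α] [Fintype β] [Fintype γ]
    (p : Ω → ℝ) (U : Ω → α) (V : Ω → β) (W : Ω → γ) : ℝ :=
  ∑ u : α, ∑ v : β, ∑ w : γ,
    fpr p {x | U x = u ∧ V x = v ∧ W x = w} *
      Real.log ((fpr p {x | U x = u ∧ V x = v ∧ W x = w} / fpr p {x | W x = w}) /
        ((fpr p {x | U x = u ∧ W x = w} / fpr p {x | W x = w}) *
          (fpr p {x | V x = v ∧ W x = w} / fpr p {x | W x = w})))

/-- The `j`-th coordinate function on the product space `∏ i, 𝒳 i`. -/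
def coordFn {d : ℕ} {𝒳 : Fin d → Type*} (j : Fin d) : (∀ i, 𝒳 i) → 𝒳 j :=
  fun x => x j

/-- The subvector map `x ↦ x_S` on the product space `∏ i, 𝒳 i`. -/
def subvFn {d : ℕ} {𝒳 : Fin d → Type*} (S : Finset (Fin d)) :
    (∀ i, 𝒳 i) → ∀ i : S, 𝒳 i.1 :=
  fun x i => x i.1

/-- The subvector map `x ↦ x_{−j}` keeping all coordinates except the `j`-th. -/
def restFn {d : ℕ} {𝒳 : Fin d → Type*} (j : Fin d) :
    (∀ i, 𝒳 i) → ∀ i : {i : Fin d // i ≠ j}, 𝒳 i.1 :=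
  fun x i => x i.1

/-- The parent set of node `j` in the directed graph `G` (edge `i → j` iff `G i j`). -/
def paSet {d : ℕ} (G : Fin d → Fin d → Prop) [DecidableRel G] (j : Fin d) :
    Finset (Fin d) :=
  Finset.univ.filter (fun i => G i j)

/-- The number of edges of the directed graph `G`. -/
def nEdges {d : ℕ} (G : Fin d → Fin d → Prop) [DecidableRel G] : ℕ :=
  ∑ j, (paSet G j).card

/-- The structural loss of a directed graph `Ĝ` on nodes `{1,…,d}`:
`L^S(Ĝ) = ∑_j Î(X_j; X_{S̄_j(Ĝ)} | X_{Pa(Ĝ,j)}) + (λ/n)|Ĝ|`, where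
`S̄_j(Ĝ) = {1,…,d} \ ({j} ∪ Pa(Ĝ,j))` and `Î` is conditional mutual information
computed under the pmf `phat`. -/
noncomputable def structLoss {d : ℕ} {𝒳 : Fin d → Type*} [∀ i, Fintype (𝒳 i)]
    (phat : (∀ i, 𝒳 i) → ℝ) (lam : ℝ) (n : ℕ)
    (G : Fin d → Fin d → Prop) [DecidableRel G] : ℝ :=
  (∑ j, fCondMI phat (coordFn j) (subvFn (Finset.univ \ insert j (paSet G j)))
      (subvFn (paSet G j))) +
    (lam / n) * (nEdges G)

/-- Conditional mutual information as an expectation of log-probabilities. -/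
theorem fCondMI_eq_sum_log {Ω α β γ : Type*} [Fintype Ω] [Fintype α] [Fintype β] [Fintype γ]
    (p : Ω → ℝ) (hp : ∀ x, 0 ≤ p x) (U : Ω → α) (V : Ω → β) (W : Ω → γ) :
    fCondMI p U V W = ∑ x, p x *
      (Real.log (fpr p {y | U y = U x ∧ V y = V x ∧ W y = W x}) +
        Real.log (fpr p {y | W y = W x}) -
        Real.log (fpr p {y | U y = U x ∧ W y = W x}) -
        Real.log (fpr p {y | V y = V x ∧ W y = W x})) := by
  classical
  have expand : ∀ f : α → β → γ → ℝ,
      ∑ u, ∑ v, ∑ w, fpr p {x | U x = u ∧ V x = v ∧ W x = w} * f u v w =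
        ∑ x, p x * f (U x) (V x) (W x) := by
    intro f
    simp only [fpr, Finset.sum_mul, Set.indicator_apply, Set.mem_ofPred_eq]
    simp_rw [Finset.sum_comm (t := (Finset.univ : Finset Ω))]
    refine Finset.sum_congr rfl fun x _ => ?_
    rw [Finset.sum_eq_single (U x), Finset.sum_eq_single (V x), Finset.sum_eq_single (W x)]
    · simp
    all_goals simp +contextual [eq_comm]
  rw [fCondMI, expand fun u v w =>
    Real.log ((fpr p {x | U x = u ∧ V x = v ∧ W x = w} / fpr p {x | W x = w}) /
        ((fpr p {x | U x = u ∧ W x = w} / fpr p {x | W x = w}) *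
          (fpr p {x | V x = v ∧ W x = w} / fpr p {x | W x = w})))]
  refine Finset.sum_congr rfl fun x _ => ?_
  rcases (hp x).eq_or_lt with h | h
  · simp [← h]
  have pos : ∀ A : Set Ω, x ∈ A → fpr p A ≠ 0 := by
    intro A hA
    refine ne_of_gt (Finset.sum_pos' (fun y _ => Set.indicator_nonneg (fun y _ => hp y) y)
      ⟨x, Finset.mem_univ x, ?_⟩)
    rwa [Set.indicator_of_mem hA]
  have h₁ := pos {y | U y = U x ∧ V y = V x ∧ W y = W x} (by simp)
  have h₂ := pos {y | W y = W x} (by simp)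
  have h₃ := pos {y | U y = U x ∧ W y = W x} (by simp)
  have h₄ := pos {y | V y = V x ∧ W y = W x} (by simp)
  rw [Real.log_div (div_ne_zero h₁ h₂) (mul_ne_zero (div_ne_zero h₃ h₂) (div_ne_zero h₄ h₂)),
    Real.log_mul (div_ne_zero h₃ h₂) (div_ne_zero h₄ h₂), Real.log_div h₁ h₂,
    Real.log_div h₃ h₂, Real.log_div h₄ h₂]
  ring

/-- A variable that is a function of the conditioning variable carries no conditional
information. -/
theorem fCondMI_eq_zero_of_determined {Ω α β γ : Type*} [Fintype Ω] [Fintype α] [Fintype β]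
    [Fintype γ] (p : Ω → ℝ) (hp : ∀ x, 0 ≤ p x) (U : Ω → α) (V : Ω → β) (W : Ω → γ)
    (h : ∀ x y, W x = W y → U x = U y) : fCondMI p U V W = 0 := by
  rw [fCondMI_eq_sum_log p hp]
  refine Finset.sum_eq_zero fun x _ => ?_
  have h₁ : {y | U y = U x ∧ V y = V x ∧ W y = W x} = {y | V y = V x ∧ W y = W x} := by
    ext y
    exact ⟨fun hy => hy.2, fun hy => ⟨h y x hy.2, hy⟩⟩
  have h₂ : {y | U y = U x ∧ W y = W x} = {y | W y = W x} := by
    ext y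
    exact ⟨fun hy => hy.2, fun hy => ⟨h y x hy, hy⟩⟩
  rw [h₁, h₂]
  ring

theorem subvFn_eq_iff {d : ℕ} {𝒳 : Fin d → Type*} (S : Finset (Fin d)) (x y : ∀ i, 𝒳 i) :
    subvFn S x = subvFn S y ↔ ∀ i ∈ S, x i = y i := by
  simp [funext_iff, subvFn]

/-- The chain rule for the conditional mutual information with a subvector, one of whose
coordinates is split off. -/
theorem fCondMI_subvFn_chain {d : ℕ} {𝒳 : Fin d → Type*} [∀ i, Fintype (𝒳 i)] {α : Type*}
    [Fintype α] (p : (∀ i, 𝒳 i) → ℝ) (hp : ∀ x, 0 ≤ p x) (U : (∀ i, 𝒳 i) → α) (k : Fin d)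
    (T A : Finset (Fin d)) (hk : k ∈ T) :
    fCondMI p U (subvFn T) (subvFn A) =
      fCondMI p U (coordFn k) (subvFn A) +
        fCondMI p U (subvFn (T.erase k)) (subvFn (insert k A)) := by
  simp only [fCondMI_eq_sum_log p hp]
  rw [← Finset.sum_add_distrib]
  refine Finset.sum_congr rfl fun x _ => ?_
  have insert_iff : ∀ y, subvFn (insert k A) y = subvFn (insert k A) x ↔
      coordFn k y = coordFn k x ∧ subvFn A y = subvFn A x := by
    intro y
    simp [subvFn_eq_iff, coordFn]
  have erase_iff : ∀ y, (subvFn (T.erase k) y = subvFn (T.erase k) x ∧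
      coordFn k y = coordFn k x ∧ subvFn A y = subvFn A x) ↔
      (subvFn T y = subvFn T x ∧ subvFn A y = subvFn A x) := by
    intro y
    have hT : subvFn T y = subvFn T x ↔ y k = x k ∧ ∀ i ∈ T.erase k, y i = x i := by
      rw [subvFn_eq_iff, ← Finset.forall_mem_insert _ _ fun i => y i = x i,
        Finset.insert_erase hk]
    rw [hT, subvFn_eq_iff (T.erase k), coordFn, coordFn]
    tauto
  simp only [insert_iff, erase_iff]
  ring

theorem structLoss_add_edge {d : ℕ} {𝒳 : Fin d → Type*} [∀ i, Fintype (𝒳 i)]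
    (p : (∀ i, 𝒳 i) → ℝ) (hp : ∀ x, 0 ≤ p x) (lam : ℝ) (n : ℕ) (j k : Fin d) (hjk : j ≠ k)
    (G : Fin d → Fin d → Prop) [DecidableRel G] (hkj : ¬ G k j) :
    structLoss p lam n (fun a b => G a b ∨ (a = k ∧ b = j)) - structLoss p lam n G =
      lam / n - fCondMI p (coordFn j) (coordFn k) (subvFn (paSet G j)) := by
  have hkA : k ∉ paSet G j := by simp [paSet, hkj]
  have pa_self : paSet (fun a b => G a b ∨ (a = k ∧ b = j)) j = insert k (paSet G j) := by
    ext i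
    simp [paSet, or_comm]
  have pa_other : ∀ i ∈ Finset.univ.erase j,
      paSet (fun a b => G a b ∨ (a = k ∧ b = j)) i = paSet G i := by
    intro i hi
    simp [paSet, Finset.ne_of_mem_erase hi]
  have hrest : Finset.univ \ insert j (insert k (paSet G j)) =
      (Finset.univ \ insert j (paSet G j)).erase k := by
    ext i
    simp
    tauto
  have chain := fCondMI_subvFn_chain p hp (coordFn j) k (Finset.univ \ insert j (paSet G j))
    (paSet G j) (by simp [hjk.symm, hkA])
  simp only [structLoss, nEdges]
  rw [← Finset.add_sum_erase _ _ (Finset.mem_univ j),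
    ← Finset.add_sum_erase _ _ (Finset.mem_univ j),
    ← Finset.add_sum_erase _ _ (Finset.mem_univ j),
    ← Finset.add_sum_erase _ _ (Finset.mem_univ j),
    Finset.sum_congr rfl fun i hi => congrArg Finset.card (pa_other i hi),
    Finset.sum_congr rfl fun i hi => congrArg (fun S => fCondMI p (coordFn i)
      (subvFn (Finset.univ \ insert i S)) (subvFn S)) (pa_other i hi),
    pa_self, hrest, chain, Finset.card_insert_of_notMem hkA]
  push_cast
  ring

/-- Under assumptions (a) and (b) relating the conditional mutual informations `Î` under `phat`
to those under the true pmf `p` via the threshold `λ/n`, for any directed graph `Ĝ` not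
containing the edge `k → j`, adding that edge changes the structural loss by exactly
`λ/n − Î(X_j; X_k | X_{Pa(Ĝ,j)})`; consequently the loss strictly increases if
`I_p(X_j; X_k | X_{Pa(Ĝ,j)}) = 0` and strictly decreases if it is nonzero. -/
theorem stmt1 {d : ℕ} {𝒳 : Fin d → Type*} [∀ i, Fintype (𝒳 i)]
    (phat : (∀ i, 𝒳 i) → ℝ) (hphat0 : ∀ x, 0 ≤ phat x) (hphat1 : ∑ x, phat x = 1)
    (p : (∀ i, 𝒳 i) → ℝ) (hp0 : ∀ x, 0 ≤ p x) (hp1 : ∑ x, p x = 1)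
    (lam : ℝ) (hlam : 0 < lam) (n : ℕ) (hn : 1 ≤ n)
    (ha : ∀ j k : Fin d, j ≠ k → ∀ S : Finset (Fin d), j ∉ S → k ∉ S →
      fCondMI p (coordFn j) (coordFn k) (subvFn S) = 0 →
        fCondMI phat (coordFn j) (coordFn k) (subvFn S) < lam / n)
    (hb : ∀ j k : Fin d, j ≠ k → ∀ S : Finset (Fin d), j ∉ S → k ∉ S →
      fCondMI p (coordFn j) (coordFn k) (subvFn S) ≠ 0 →
        lam / n < fCondMI phat (coordFn j) (coordFn k) (subvFn S))
    (j k : Fin d) (hjk : j ≠ k)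
    (G : Fin d → Fin d → Prop) [DecidableRel G] (hkj : ¬ G k j) :
    structLoss phat lam n (fun a b => G a b ∨ (a = k ∧ b = j)) - structLoss phat lam n G =
        lam / n - fCondMI phat (coordFn j) (coordFn k) (subvFn (paSet G j)) ∧
      (fCondMI p (coordFn j) (coordFn k) (subvFn (paSet G j)) = 0 →
        structLoss phat lam n G <
          structLoss phat lam n (fun a b => G a b ∨ (a = k ∧ b = j))) ∧
      (fCondMI p (coordFn j) (coordFn k) (subvFn (paSet G j)) ≠ 0 →
        structLoss phat lam n (fun a b => G a b ∨ (a = k ∧ b = j)) <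
          structLoss phat lam n G) := by
  have key := structLoss_add_edge phat hphat0 lam n j k hjk G hkj
  have hn' : (0 : ℝ) < n := by exact_mod_cast hn
  have hkA : k ∉ paSet G j := by simp [paSet, hkj]
  refine ⟨key, fun h => ?_, fun h => ?_⟩ <;> by_cases hjA : j ∈ paSet G j
  · have hzero := fCondMI_eq_zero_of_determined phat hphat0 (coordFn j) (coordFn k)
      (subvFn (paSet G j)) fun x y hxy => (subvFn_eq_iff _ x y).1 hxy j hjA
    have hpos := div_pos hlam hn'
    linarith
  · linarith [ha j k hjk _ hjA hkA h]
  · exact absurd (fCondMI_eq_zero_of_determined p hp0 (coordFn j) (coordFn k)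
      (subvFn (paSet G j)) fun x y hxy => (subvFn_eq_iff _ x y).1 hxy j hjA) h
  · linarith [hb j k hjk _ hjA hkA h]
end

section
/- Let X = (X_1,…,X_d) be a random vector on a probability space, each X_i taking values in a finite type, with joint pmf p. Fix an index j and a subset S ⊆ {1,…,d} \ {j}, and set S̄ := {1,…,d} \ ({j} ∪ S). Let q(·|x_S) be any family of conditional pmfs on 𝒳_j indexed by configurations x_S, with q(x_j|x_S) > 0 whenever P(X_j = x_j, X_S = x_S) > 0. Then the expected negative conditional log-likelihood decomposes into three terms: E_p[ −log q(X_j | X_S) ] = ∑_{x_S} P(X_S = x_S) · D_KL( p(· | x_S) ‖ q(· | x_S) ) + I(X_j; X_{S̄} | X_S) + H(X_j | X_{−j}). -/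
theorem sum_fpr_mul {Ω α : Type*} [Fintype Ω] [Fintype α] (p : Ω → ℝ) (U : Ω → α)
    (g : α → ℝ) : ∑ u, fpr p {x | U x = u} * g u = ∑ x, p x * g (U x) := by
  simp only [fpr, Finset.sum_mul]
  rw [Finset.sum_comm]
  refine Finset.sum_congr rfl fun x _ => ?_
  rw [Finset.sum_eq_single (U x)]
  · simp
  · intro u _ hu
    simp [hu.symm]
  · simp

theorem sum_sum_fpr_mul {Ω α β : Type*} [Fintype Ω] [Fintype α] [Fintype β] (p : Ω → ℝ)
    (U : Ω → α) (V : Ω → β) (g : α → β → ℝ) :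
    ∑ u, ∑ v, fpr p {x | U x = u ∧ V x = v} * g u v = ∑ x, p x * g (U x) (V x) := by
  simpa [Fintype.sum_prod_type, Prod.mk.injEq] using
    sum_fpr_mul p (fun x => (U x, V x)) (fun z => g z.1 z.2)

theorem sum_sum_sum_fpr_mul {Ω α β γ : Type*} [Fintype Ω] [Fintype α] [Fintype β] [Fintype γ]
    (p : Ω → ℝ) (U : Ω → α) (V : Ω → β) (W : Ω → γ) (g : α → β → γ → ℝ) :
    ∑ u, ∑ v, ∑ w, fpr p {x | U x = u ∧ V x = v ∧ W x = w} * g u v w =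
      ∑ x, p x * g (U x) (V x) (W x) := by
  simpa [Fintype.sum_prod_type, Prod.mk.injEq] using
    sum_fpr_mul p (fun x => (U x, V x, W x)) (fun z => g z.1 z.2.1 z.2.2)

theorem fpr_nonneg {Ω : Type*} [Fintype Ω] {p : Ω → ℝ} (hp : ∀ x, 0 ≤ p x) (A : Set Ω) :
    0 ≤ fpr p A :=
  Finset.sum_nonneg fun x _ => Set.indicator_nonneg (fun y _ => hp y) x

theorem fpr_mono {Ω : Type*} [Fintype Ω] {p : Ω → ℝ} (hp : ∀ x, 0 ≤ p x) {A B : Set Ω}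
    (hAB : A ⊆ B) : fpr p A ≤ fpr p B :=
  Finset.sum_le_sum fun x _ => Set.indicator_le_indicator_of_subset hAB hp x

theorem fpr_pos_of_mem {Ω : Type*} [Fintype Ω] {p : Ω → ℝ} (hp : ∀ x, 0 ≤ p x) {A : Set Ω}
    {x : Ω} (hx : 0 < p x) (hxA : x ∈ A) : 0 < fpr p A :=
  Finset.sum_pos' (fun y _ => Set.indicator_nonneg (fun z _ => hp z) y)
    ⟨x, Finset.mem_univ x, by simpa [hxA] using hx⟩

theorem sum_fpr_mul_sum_cond_mul {Ω α β : Type*} [Fintype Ω] [Fintype α] [Fintype β]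
    {p : Ω → ℝ} (hp : ∀ x, 0 ≤ p x) (U : Ω → α) (W : Ω → β) (g : α → β → ℝ) :
    ∑ w, fpr p {x | W x = w} *
        ∑ u, fpr p {x | U x = u ∧ W x = w} / fpr p {x | W x = w} * g u w =
      ∑ x, p x * g (U x) (W x) := by
  rw [← sum_sum_fpr_mul p U W g, Finset.sum_comm (f := fun u w => _ * g u w)]
  refine Finset.sum_congr rfl fun w _ => ?_
  rw [Finset.mul_sum]
  refine Finset.sum_congr rfl fun u _ => ?_
  have hle : fpr p {x | U x = u ∧ W x = w} ≤ fpr p {x | W x = w} :=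
    fpr_mono hp fun x hx => hx.2
  rcases eq_or_ne (fpr p {x | W x = w}) 0 with h | h
  · have h0 : fpr p {x | U x = u ∧ W x = w} = 0 :=
      le_antisymm (hle.trans h.le) (fpr_nonneg hp _)
    simp [h, h0]
  · rw [← mul_assoc, mul_div_cancel₀ _ h]

theorem restFn_eq_iff {d : ℕ} {𝒳 : Fin d → Type*} {j : Fin d} {S : Finset (Fin d)}
    (hjS : j ∉ S) (x y : ∀ i, 𝒳 i) :
    restFn j x = restFn j y ↔
      subvFn (Finset.univ \ insert j S) x = subvFn (Finset.univ \ insert j S) y ∧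
        subvFn S x = subvFn S y := by
  simp only [funext_iff, restFn, subvFn, Subtype.forall, Finset.mem_sdiff, Finset.mem_univ,
    Finset.mem_insert, true_and, not_or]
  constructor
  · exact fun h => ⟨fun i hi => h i hi.1, fun i hi => h i fun hij => hjS (hij ▸ hi)⟩
  · intro h i hi
    by_cases hiS : i ∈ S
    · exact h.2 i hiS
    · exact h.1 i ⟨hi, hiS⟩

theorem neg_log_eq_log_div_add_log_div_sub_log_div {a b c e q : ℝ} (ha : 0 < a) (hb : 0 < b)
    (hc : 0 < c) (he : 0 < e) (hq : 0 < q) :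
    -Real.log q =
      Real.log (b / a / q) + Real.log (e / a / (b / a * (c / a))) - Real.log (e / c) := by
  rw [Real.log_div (div_pos hb ha).ne' hq.ne',
    Real.log_div (div_pos he ha).ne' (mul_pos (div_pos hb ha) (div_pos hc ha)).ne',
    Real.log_mul (div_pos hb ha).ne' (div_pos hc ha).ne', Real.log_div hb.ne' ha.ne',
    Real.log_div he.ne' ha.ne', Real.log_div hc.ne' ha.ne', Real.log_div he.ne' hc.ne']
  ring

/-- For a random vector with joint pmf `p` on the finite product space `∏ i, 𝒳 i`, an index
`j`, a subset `S ⊆ {1,…,d} \ {j}` with complement `S̄ = {1,…,d} \ ({j} ∪ S)`, and any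
family `q(·|x_S)` of conditional pmfs on `𝒳 j` positive on the support of `p`, the expected
negative conditional log-likelihood decomposes into three terms:
`E_p[−log q(X_j|X_S)] = ∑_y P(X_S=y)·D_KL(p(·|y)‖q(·|y)) + I(X_j; X_{S̄} | X_S) + H(X_j|X_{−j})`. -/
theorem stmt8 {d : ℕ} {𝒳 : Fin d → Type*} [∀ i, Fintype (𝒳 i)]
    (p : (∀ i, 𝒳 i) → ℝ) (hp0 : ∀ x, 0 ≤ p x) (hp1 : ∑ x, p x = 1)
    (j : Fin d) (S : Finset (Fin d)) (hjS : j ∉ S)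
    (q : (∀ i : S, 𝒳 i.1) → 𝒳 j → ℝ)
    (hq0 : ∀ y a, 0 ≤ q y a) (hq1 : ∀ y, ∑ a, q y a = 1)
    (hqpos : ∀ x : ∀ i, 𝒳 i, 0 < p x → 0 < q (subvFn S x) (x j)) :
    -- expected negative conditional log-likelihood
    ∑ x, p x * (-Real.log (q (subvFn S x) (x j))) =
      -- ∑_y P(X_S = y) · D_KL( p(·|y) ‖ q(·|y) )
      (∑ y, fpr p {x | subvFn S x = y} *
        (∑ a, (fpr p {x | x j = a ∧ subvFn S x = y} / fpr p {x | subvFn S x = y}) *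
          Real.log ((fpr p {x | x j = a ∧ subvFn S x = y} / fpr p {x | subvFn S x = y}) /
            q y a))) +
      -- conditional mutual information I(X_j ; X_{S̄} | X_S)
      fCondMI p (coordFn j) (subvFn (Finset.univ \ insert j S)) (subvFn S) +
      -- conditional entropy H(X_j | X_{−j})
      (-(∑ a, ∑ y, fpr p {x | x j = a ∧ restFn j x = y} *
          Real.log (fpr p {x | x j = a ∧ restFn j x = y} /
            fpr p {x | restFn j x = y}))) := by
  rw [sum_fpr_mul_sum_cond_mul hp0 (fun x => x j) (subvFn S) fun a y =>
      Real.log (fpr p {x | x j = a ∧ subvFn S x = y} / fpr p {x | subvFn S x = y} / q y a),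
    fCondMI, sum_sum_sum_fpr_mul p (coordFn j) (subvFn (Finset.univ \ insert j S)) (subvFn S)
      fun u v w => Real.log
        (fpr p {x | coordFn j x = u ∧ subvFn (Finset.univ \ insert j S) x = v ∧ subvFn S x = w} /
            fpr p {x | subvFn S x = w} /
          (fpr p {x | coordFn j x = u ∧ subvFn S x = w} / fpr p {x | subvFn S x = w} *
            (fpr p {x | subvFn (Finset.univ \ insert j S) x = v ∧ subvFn S x = w} /
              fpr p {x | subvFn S x = w}))),
    sum_sum_fpr_mul p (fun x => x j) (restFn j) fun a y => Real.log
      (fpr p {x | x j = a ∧ restFn j x = y} / fpr p {x | restFn j x = y}),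
    ← sub_eq_add_neg, ← Finset.sum_add_distrib, ← Finset.sum_sub_distrib]
  refine Finset.sum_congr rfl fun x _ => ?_
  rcases (hp0 x).eq_or_lt with hx | hx
  · simp [← hx]
  · simp only [restFn_eq_iff hjS, coordFn, ← mul_add, ← mul_sub]
    congr 1
    apply neg_log_eq_log_div_add_log_div_sub_log_div _ _ _ _ (hqpos x hx) <;>
      exact fpr_pos_of_mem hp0 hx (by simp)
end

section
/- Let μ and ν be probability measures on a measurable space with μ absolutely continuous with respect to ν, and suppose log(dμ/dν) is μ-integrable, so that the Kullback–Leibler divergence KL(μ‖ν) = ∫ log(dμ/dν) dμ is finite. Then for every measurable function T such that T is μ-integrable and exp(T − 1) is ν-integrable, ∫ T dμ − ∫ exp(T − 1) dν ≤ KL(μ‖ν). (This is the variational lower bound of Nguyen, Wainwright and Jordan underlying SAM's adversarial estimation of the fit loss.) -/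
open MeasureTheory

/-- The Fenchel–Young inequality for `r ↦ r * log r` and its conjugate `t ↦ exp (t - 1)`. -/
lemma mul_le_mul_log_add_exp_sub_one {r : ℝ} (hr : 0 ≤ r) (t : ℝ) :
    r * t ≤ r * Real.log r + Real.exp (t - 1) := by
  rcases hr.eq_or_lt with rfl | hr
  · simpa using (Real.exp_pos (t - 1)).le
  · have hexp : Real.exp (t - 1) = r * Real.exp (t - 1 - Real.log r) := by
      rw [Real.exp_sub _ (Real.log r), Real.exp_log hr]
      field_simp
    have hmul := mul_le_mul_of_nonneg_left (Real.add_one_le_exp (t - 1 - Real.log r)) hr.le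
    rw [hexp]
    linarith

/-- Variational lower bound of Nguyen, Wainwright and Jordan: if `μ ≪ ν` are probability
measures with finite Kullback–Leibler divergence `KL(μ‖ν) = ∫ log (dμ/dν) dμ`, then for
every measurable `T` with `T` `μ`-integrable and `exp(T − 1)` `ν`-integrable,
`∫ T dμ − ∫ exp(T − 1) dν ≤ KL(μ‖ν)`. -/
theorem stmt11 {α : Type*} [MeasurableSpace α] (μ ν : Measure α)
    [IsProbabilityMeasure μ] [IsProbabilityMeasure ν] (hac : μ ≪ ν)
    (hKL : Integrable (fun x => Real.log ((μ.rnDeriv ν x).toReal)) μ)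
    (T : α → ℝ) (hT : Measurable T) (hTμ : Integrable T μ)
    (hTν : Integrable (fun x => Real.exp (T x - 1)) ν) :
    ∫ x, T x ∂μ - ∫ x, Real.exp (T x - 1) ∂ν ≤
      ∫ x, Real.log ((μ.rnDeriv ν x).toReal) ∂μ := by
  have hTν' := (integrable_rnDeriv_smul_iff hac).mpr hTμ
  have hKLν := (integrable_rnDeriv_smul_iff hac).mpr hKL
  have key := integral_mono hTν' (hKLν.add hTν) fun x =>
    mul_le_mul_log_add_exp_sub_one (ENNReal.toReal_nonneg (a := μ.rnDeriv ν x)) (T x)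
  rw [integral_add' hKLν hTν, integral_rnDeriv_smul hac, integral_rnDeriv_smul hac] at key
  exact sub_le_iff_le_add.mpr key
end

section
/- Let μ and ν be probability measures on a measurable space with μ absolutely continuous with respect to ν, with density f = dμ/dν satisfying f > 0 ν-almost everywhere, and suppose log f is μ-integrable. Then the function T* := 1 + log f attains the variational bound exactly: ∫ T* dμ − ∫ exp(T* − 1) dν = KL(μ‖ν). (Hence the supremum over measurable test functions T of ∫T dμ − ∫exp(T−1) dν equals the Kullback–Leibler divergence.) -/
open MeasureTheory

/-- If `μ ≪ ν` are probability measures with density `f = dμ/dν` positive `ν`-a.e. and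
`log f` is `μ`-integrable, then the test function `T* = 1 + log f` attains the variational
bound exactly: `∫ T* dμ − ∫ exp(T* − 1) dν = KL(μ‖ν)`. -/
theorem stmt12 {α : Type*} [MeasurableSpace α] (μ ν : Measure α)
    [IsProbabilityMeasure μ] [IsProbabilityMeasure ν] (hac : μ ≪ ν)
    (f : α → ℝ) (hf : f = fun x => (μ.rnDeriv ν x).toReal)
    (hpos : ∀ᵐ x ∂ν, 0 < f x)
    (hKL : Integrable (fun x => Real.log (f x)) μ)
    (Tstar : α → ℝ) (hTstar : Tstar = fun x => 1 + Real.log (f x)) :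
    ∫ x, Tstar x ∂μ - ∫ x, Real.exp (Tstar x - 1) ∂ν =
      ∫ x, Real.log (f x) ∂μ := by
  subst hf hTstar
  have hexp : ∫ x, Real.exp (1 + Real.log (μ.rnDeriv ν x).toReal - 1) ∂ν = 1 := by
    calc ∫ x, Real.exp (1 + Real.log (μ.rnDeriv ν x).toReal - 1) ∂ν
        = ∫ x, (μ.rnDeriv ν x).toReal ∂ν := by
          refine integral_congr_ae ?_
          filter_upwards [hpos] with x hx
          rw [add_sub_cancel_left, Real.exp_log hx]
      _ = 1 := by
          rw [Measure.integral_toReal_rnDeriv hac, probReal_univ]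
  rw [hexp, integral_add (integrable_const 1) hKL, integral_const, probReal_univ, one_smul,
    add_sub_cancel_left]
end

section
/- Let d ≥ 1 and let G be a directed graph on the vertex set {1,…,d} with real adjacency matrix A, where A i j = 1 if G has an edge i → j and A i j = 0 otherwise. Then ∑_{k=1}^{d} trace(A^k)/k! = 0 if and only if G is acyclic, i.e. G contains no directed cycle (no sequence of vertices v_0, v_1, …, v_m with m ≥ 1, v_m = v_0, and an edge v_t → v_{t+1} for every t < m). (This is the algebraic acyclicity criterion used as the DAG penalty in SAM's learning objective.) -/
namespace Matrix

variable {n R : Type*} [Fintype n] [DecidableEq n]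

/-- An entry of a power of a nonnegative matrix is positive if there is a walk of that length
along positive entries. -/
theorem pow_apply_pos_of_walk [Semiring R] [PartialOrder R] [IsStrictOrderedRing R]
    {A : Matrix n n R} (hA : ∀ i j, 0 ≤ A i j) (v : ℕ → n) (k : ℕ)
    (hv : ∀ t < k, 0 < A (v t) (v (t + 1))) : 0 < (A ^ k) (v 0) (v k) := by
  induction k with
  | zero => simp
  | succ k ih =>
    rw [pow_succ, mul_apply]
    exact Finset.sum_pos' (fun l _ => mul_nonneg (pow_apply_nonneg hA k _ l) (hA l _))
      ⟨v k, Finset.mem_univ _,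
        mul_pos (ih fun t ht => hv t (ht.trans k.lt_succ_self)) (hv k k.lt_succ_self)⟩

/-- A nonzero entry of a matrix power yields a walk of that length along nonzero entries. -/
theorem exists_walk_of_pow_apply_ne_zero [Semiring R] {A : Matrix n n R} {k : ℕ} {i j : n}
    (h : (A ^ k) i j ≠ 0) :
    ∃ v : ℕ → n, v 0 = i ∧ v k = j ∧ ∀ t < k, A (v t) (v (t + 1)) ≠ 0 := by
  induction k generalizing i with
  | zero =>
    refine ⟨fun _ => i, rfl, ?_, by simp⟩
    by_contra hij
    exact h (by rw [pow_zero, one_apply_ne hij])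
  | succ k ih =>
    rw [pow_succ', mul_apply] at h
    obtain ⟨l, -, hl⟩ := Finset.exists_ne_zero_of_sum_ne_zero h
    obtain ⟨v, hv0, hvk, hv⟩ := ih (right_ne_zero_of_mul hl)
    refine ⟨fun t => Nat.casesOn t i v, rfl, hvk, ?_⟩
    rintro (_ | t) ht
    · simpa [hv0] using left_ne_zero_of_mul hl
    · exact hv t (Nat.lt_of_succ_lt_succ ht)

end Matrix

/-- A relation on a finite type that has a closed walk of positive length has one of length at
most the number of points. -/
theorem exists_closed_walk_le_card {V : Type*} [Fintype V] {r : V → V → Prop}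
    (h : ∃ (m : ℕ) (v : ℕ → V), 1 ≤ m ∧ v m = v 0 ∧ ∀ t < m, r (v t) (v (t + 1))) :
    ∃ (m : ℕ) (v : ℕ → V), 1 ≤ m ∧ m ≤ Fintype.card V ∧ v m = v 0 ∧
      ∀ t < m, r (v t) (v (t + 1)) := by
  classical
  obtain ⟨v, hm, hclosed, hv⟩ := Nat.find_spec h
  refine ⟨Nat.find h, v, hm, ?_, hclosed, hv⟩
  by_contra! hlt
  obtain ⟨a, b, hab, heq⟩ := Fintype.exists_ne_map_eq_of_card_lt
    (fun t : Fin (Nat.find h) => v t) (by simpa using hlt)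
  wlog hlt' : a < b generalizing a b
  · exact this b a hab.symm heq.symm (lt_of_le_of_ne (not_lt.mp hlt') hab.symm)
  have hab' : (a : ℕ) < b := hlt'
  refine Nat.find_min h (m := b - a) (by omega) ⟨fun t => v (a + t), by omega, ?_, ?_⟩
  · simpa [Nat.add_sub_cancel' hab'.le] using heq.symm
  · exact fun t ht => hv (a + t) (by omega)

/-- Algebraic acyclicity criterion: for a directed graph `G` on `{1,…,d}` (`d ≥ 1`) with
0/1 real adjacency matrix `A`, `∑_{k=1}^{d} trace(A^k)/k! = 0` if and only if `G` contains
no directed cycle (no closed directed walk of positive length). -/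
theorem stmt13 {d : ℕ} (hd : 1 ≤ d) (G : Fin d → Fin d → Prop) [DecidableRel G]
    (A : Matrix (Fin d) (Fin d) ℝ) (hA : ∀ i j, A i j = if G i j then 1 else 0) :
    (∑ k ∈ Finset.Icc 1 d, Matrix.trace (A ^ k) / (Nat.factorial k : ℝ)) = 0 ↔
      ¬ ∃ (m : ℕ) (v : ℕ → Fin d), 1 ≤ m ∧ v m = v 0 ∧ ∀ t < m, G (v t) (v (t + 1)) := by
  have hA0 : ∀ i j, 0 ≤ A i j := fun i j => by
    rw [hA]
    split_ifs <;> simp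
  have hterm : ∀ k ∈ Finset.Icc 1 d, 0 ≤ Matrix.trace (A ^ k) / (Nat.factorial k : ℝ) :=
    fun k _ => div_nonneg (Finset.sum_nonneg fun i _ => Matrix.pow_apply_nonneg hA0 k i i)
      (Nat.cast_nonneg _)
  rw [Finset.sum_eq_zero_iff_of_nonneg hterm]
  constructor
  · intro h hcycle
    obtain ⟨m, v, hm, hmd, hclosed, hv⟩ := exists_closed_walk_le_card hcycle
    rw [Fintype.card_fin] at hmd
    have hpos := Matrix.pow_apply_pos_of_walk hA0 v m fun t ht => by simp [hA, hv t ht]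
    rw [hclosed] at hpos
    have htrace : 0 < Matrix.trace (A ^ m) :=
      Finset.sum_pos' (fun i _ => Matrix.pow_apply_nonneg hA0 m i i)
        ⟨v 0, Finset.mem_univ _, hpos⟩
    exact (div_pos htrace (Nat.cast_pos.mpr m.factorial_pos)).ne'
      (h m (Finset.mem_Icc.mpr ⟨hm, hmd⟩))
  · intro h k hk
    rw [Matrix.trace, Finset.sum_eq_zero, zero_div]
    intro i _
    by_contra hne
    obtain ⟨v, hv0, hvk, hv⟩ := Matrix.exists_walk_of_pow_apply_ne_zero hne
    exact h ⟨k, v, (Finset.mem_Icc.mp hk).1, hvk.trans hv0.symm,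
      fun t ht => by simpa [hA] using hv t ht⟩
end
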